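/- Let p₁, p₂ and d be tropical polynomial functions on ℝⁿ such that the divisions of p₁ and p₂ by d have remainder −∞, i.e., p₁(x) = d(x) + Q(p₁,d)(x) and p₂(x) = d(x) + Q(p₂,d)(x) for all x ∈ ℝⁿ. Then for every x ∈ ℝⁿ, Q(p₁ + p₂, d)(x) = Q(p₁,d)(x) + Q(p₂,d)(x) + d(x) and Q(p₁ ∨ p₂, d)(x) = max( Q(p₁,d)(x), Q(p₂,d)(x) ). -/

import Mathlib

open scoped BigOperators

/-- `p : ℝⁿ → ℝ` is a tropical polynomial function if it is a finite max of
affine functions. -/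
def IsTropPoly {n : ℕ} (p : (Fin n → ℝ) → ℝ) : Prop :=
  ∃ (m : ℕ) (a : Fin (m + 1) → Fin n → ℝ) (b : Fin (m + 1) → ℝ),
    ∀ x, p x = ⨆ i, ((∑ j, a i j * x j) + b i)

/-- The quotient function of the tropical division of `p` by `d`:
`Q(p,d)(x) = sup { a·x + b : d(y) + a·y + b ≤ p(y) for all y }`,
valued in the extended reals (so `sup ∅ = ⊥ = -∞`). -/
noncomputable def Qdiv {n : ℕ} (p d : (Fin n → ℝ) → ℝ) (x : Fin n → ℝ) : EReal :=
  sSup (Real.toEReal ''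
    {v : ℝ | ∃ (a : Fin n → ℝ) (b : ℝ), v = (∑ j, a j * x j) + b ∧
      ∀ y, d y + ((∑ j, a j * y j) + b) ≤ p y})

lemma IsTropPoly.exists_affine_minorant {n : ℕ} {d : (Fin n → ℝ) → ℝ} (hd : IsTropPoly d)
    (x : Fin n → ℝ) :
    ∃ (a : Fin n → ℝ) (b : ℝ), d x = (∑ j, a j * x j) + b ∧
      ∀ y, (∑ j, a j * y j) + b ≤ d y := by
  obtain ⟨m, a, b, h⟩ := hd
  obtain ⟨i, hi⟩ := exists_eq_ciSup_of_finite (f := fun i => (∑ j, a i j * x j) + b i)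
  refine ⟨a i, b i, by rw [h x, ← hi], fun y => ?_⟩
  rw [h y]
  exact le_ciSup (f := fun i => (∑ j, a i j * y j) + b i) (Set.finite_range _).bddAbove i

lemma Qdiv_le_sub {n : ℕ} (p d : (Fin n → ℝ) → ℝ) (x : Fin n → ℝ) :
    Qdiv p d x ≤ ((p x - d x : ℝ) : EReal) := by
  refine sSup_le ?_
  rintro _ ⟨_, ⟨a, b, rfl, h⟩, rfl⟩
  exact EReal.coe_le_coe_iff.2 (by linarith [h x])

lemma le_Qdiv {n : ℕ} {p d : (Fin n → ℝ) → ℝ} {a : Fin n → ℝ} {b : ℝ}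
    (h : ∀ y, d y + ((∑ j, a j * y j) + b) ≤ p y) (x : Fin n → ℝ) :
    (((∑ j, a j * x j) + b : ℝ) : EReal) ≤ Qdiv p d x :=
  le_sSup ⟨_, ⟨a, b, rfl, h⟩, rfl⟩

lemma Qdiv_mono {n : ℕ} {p q d : (Fin n → ℝ) → ℝ} (h : ∀ y, p y ≤ q y) (x : Fin n → ℝ) :
    Qdiv p d x ≤ Qdiv q d x := by
  refine sSup_le ?_
  rintro _ ⟨_, ⟨a, b, rfl, hab⟩, rfl⟩
  exact le_Qdiv (fun y => (hab y).trans (h y)) x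

lemma Qdiv_eq_sub {n : ℕ} {p d : (Fin n → ℝ) → ℝ} {x : Fin n → ℝ}
    (h : (p x : EReal) = (d x : EReal) + Qdiv p d x) :
    Qdiv p d x = ((p x - d x : ℝ) : EReal) := by
  generalize Qdiv p d x = q at h
  induction q with
  | bot => simp at h
  | top => simp at h
  | coe q =>
    norm_cast at h ⊢
    linarith

lemma exists_affine_of_lt_Qdiv {n : ℕ} {p d : (Fin n → ℝ) → ℝ} {x : Fin n → ℝ} {c : ℝ}
    (h : (c : EReal) < Qdiv p d x) :
    ∃ (a : Fin n → ℝ) (b : ℝ), c < (∑ j, a j * x j) + b ∧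
      ∀ y, d y + ((∑ j, a j * y j) + b) ≤ p y := by
  obtain ⟨_, ⟨_, ⟨a, b, rfl, hab⟩, rfl⟩, hc⟩ := lt_sSup_iff.1 h
  exact ⟨a, b, EReal.coe_lt_coe_iff.1 hc, hab⟩

/-- If the divisions of `p₁` and `p₂` by `d` both have remainder `-∞`, i.e.
`pₗ = d + Q(pₗ, d)` pointwise, then
`Q(p₁ + p₂, d) = Q(p₁, d) + Q(p₂, d) + d` and
`Q(p₁ ∨ p₂, d) = max(Q(p₁, d), Q(p₂, d))` pointwise, in `ℝ ∪ {-∞}`. -/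
theorem stmt17 {n : ℕ} (p₁ p₂ d : (Fin n → ℝ) → ℝ)
    (hp₁ : IsTropPoly p₁) (hp₂ : IsTropPoly p₂) (hd : IsTropPoly d)
    (hr₁ : ∀ x, (p₁ x : EReal) = (d x : EReal) + Qdiv p₁ d x)
    (hr₂ : ∀ x, (p₂ x : EReal) = (d x : EReal) + Qdiv p₂ d x) :
    ∀ x, Qdiv (fun y => p₁ y + p₂ y) d x =
        Qdiv p₁ d x + Qdiv p₂ d x + (d x : EReal) ∧
      Qdiv (fun y => max (p₁ y) (p₂ y)) d x =
        max (Qdiv p₁ d x) (Qdiv p₂ d x) := by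
  intro x
  have h₁ := Qdiv_eq_sub (hr₁ x)
  have h₂ := Qdiv_eq_sub (hr₂ x)
  constructor
  · have key : Qdiv (fun y => p₁ y + p₂ y) d x = ((p₁ x + p₂ x - d x : ℝ) : EReal) := by
      refine le_antisymm (Qdiv_le_sub _ _ x) (le_of_forall_lt fun c hc => ?_)
      obtain ⟨z, hcz, hz⟩ := EReal.lt_iff_exists_real_btwn.1 hc
      have hz' := EReal.coe_lt_coe_iff.1 hz
      set ε := (p₁ x + p₂ x - d x - z) / 2 with hε
      obtain ⟨a₁, b₁, hx₁, hy₁⟩ := exists_affine_of_lt_Qdiv (p := p₁) (d := d) (x := x)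
        (c := p₁ x - d x - ε) (by rw [h₁]; exact EReal.coe_lt_coe_iff.2 (by linarith))
      obtain ⟨a₂, b₂, hx₂, hy₂⟩ := exists_affine_of_lt_Qdiv (p := p₂) (d := d) (x := x)
        (c := p₂ x - d x - ε) (by rw [h₂]; exact EReal.coe_lt_coe_iff.2 (by linarith))
      obtain ⟨a, b, hx, hy⟩ := hd.exists_affine_minorant x
      have hsum (y : Fin n → ℝ) : (∑ j, (a₁ + a₂ + a) j * y j) + (b₁ + b₂ + b) =
          ((∑ j, a₁ j * y j) + b₁) + ((∑ j, a₂ j * y j) + b₂) + ((∑ j, a j * y j) + b) := by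
        simp only [Pi.add_apply, add_mul, Finset.sum_add_distrib]
        ring
      refine (hcz.trans (EReal.coe_lt_coe_iff.2 ?_)).trans_le
        (le_Qdiv (a := a₁ + a₂ + a) (b := b₁ + b₂ + b) (fun y => ?_) x)
      · rw [hsum]
        linarith
      · rw [hsum]
        linarith [hy₁ y, hy₂ y, hy y]
    rw [key, h₁, h₂]
    norm_cast
    ring
  · refine le_antisymm ?_ (max_le (Qdiv_mono (fun y => le_max_left _ _) x)
      (Qdiv_mono (fun y => le_max_right _ _) x))
    refine (Qdiv_le_sub _ _ x).trans ?_
    rw [h₁, h₂, ← EReal.coe_strictMono.monotone.map_max, max_sub_sub_right]
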